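/- (Configuration H(8,136)) Let Z be a set of 8 points in the complex projective plane ℙ² forming the following configuration: a line ℓ containing exactly five of the points, among them two points Q₁ and Q₂; a point P not on ℓ; a point A on the line PQ₁ with A ∉ {P, Q₁} and A ∉ ℓ; a point B on the line PQ₂ with B ∉ {P, Q₂} and B ∉ ℓ; the intersection point of the line through A and B with ℓ does not belong to Z; and the only triples of collinear points among the eight are those contained in ℓ, in the line through P, Q₁, A, and in the line through P, Q₂, B. Let I be the radical homogeneous ideal of Z. Then α̂(I) = 17/7. -/

import Mathlib

open scoped LinearAlgebra.Projectivization

/-- A polynomial `F` vanishes to order at least `m` at the (affine representative) point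
`v`: all iterated partial derivatives of order `≤ m - 1` (i.e. of order `< m`) vanish at `v`. -/
def VanishesToOrder (m : ℕ) (F : MvPolynomial (Fin 3) ℂ) (v : Fin 3 → ℂ) : Prop :=
  ∀ k : ℕ, k < m → ∀ d : Fin k → Fin 3,
    MvPolynomial.eval v ((List.ofFn d).foldl (fun p i => MvPolynomial.pderiv i p) F) = 0

/-- The `m`-th symbolic power of the (radical) ideal of a set `Z` of points of `ℙ²`:
all polynomials vanishing to order at least `m` at every point of `Z`. -/
def symbolicPower (Z : Set (ℙ ℂ (Fin 3 → ℂ))) (m : ℕ) : Set (MvPolynomial (Fin 3) ℂ) :=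
  {F | ∀ P ∈ Z, ∀ (v : Fin 3 → ℂ) (hv : v ≠ 0),
    Projectivization.mk ℂ v hv = P → VanishesToOrder m F v}

/-- The initial degree `α` of a set of polynomials: the least `t` such that the set contains
a nonzero homogeneous polynomial of degree `t`. -/
noncomputable def initialDegree (S : Set (MvPolynomial (Fin 3) ℂ)) : ℕ :=
  sInf {t | ∃ F ∈ S, F ≠ 0 ∧ F.IsHomogeneous t}

/-- The Waldschmidt constant `α̂(I) = inf_{m ≥ 1} α(I^(m))/m` of the radical ideal of `Z`. -/
noncomputable def waldschmidt (Z : Set (ℙ ℂ (Fin 3 → ℂ))) : ℝ :=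
  ⨅ m : ℕ+, (initialDegree (symbolicPower Z (m : ℕ)) : ℝ) / ((m : ℕ) : ℝ)

/-- A (homogeneous equation of a) line in `ℙ²`: a nonzero homogeneous polynomial of degree 1. -/
def IsLine (L : MvPolynomial (Fin 3) ℂ) : Prop := L ≠ 0 ∧ L.IsHomogeneous 1

/-- The point `x ∈ ℙ²` lies on the line (or curve) with equation `L`. -/
def MemLine (L : MvPolynomial (Fin 3) ℂ) (x : ℙ ℂ (Fin 3 → ℂ)) : Prop :=
  ∀ (v : Fin 3 → ℂ) (hv : v ≠ 0), Projectivization.mk ℂ v hv = x → MvPolynomial.eval v L = 0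

/-- Three points of `ℙ²` are collinear if some line contains all of them. -/
def Collin (x y z : ℙ ℂ (Fin 3 → ℂ)) : Prop :=
  ∃ M, IsLine M ∧ MemLine M x ∧ MemLine M y ∧ MemLine M z

/-- `Z` is contained in a conic: the zero set of a nonzero homogeneous polynomial of degree 2
(possibly degenerate). -/
def ContainedInConic (Z : Set (ℙ ℂ (Fin 3 → ℂ))) : Prop :=
  ∃ F : MvPolynomial (Fin 3) ℂ, F ≠ 0 ∧ F.IsHomogeneous 2 ∧ ∀ x ∈ Z, MemLine F x

section AuxiliaryResults

open MvPolynomial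

/-! ### Orders of vanishing -/

section VanishesToOrder

variable {m n : ℕ} {F G : MvPolynomial (Fin 3) ℂ} {v : Fin 3 → ℂ}

theorem vanishesToOrder_zero (F : MvPolynomial (Fin 3) ℂ) (v : Fin 3 → ℂ) :
    VanishesToOrder 0 F v := fun _ hk => absurd hk (Nat.not_lt_zero _)

theorem vanishesToOrder_succ :
    VanishesToOrder (m + 1) F v ↔ eval v F = 0 ∧ ∀ i, VanishesToOrder m (pderiv i F) v := by
  constructor
  · intro h
    refine ⟨by simpa using h 0 (Nat.succ_pos m) Fin.elim0, fun i k hk d => ?_⟩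
    simpa [List.ofFn_succ] using h (k + 1) (by omega) (Fin.cons i d)
  · rintro ⟨h₀, h⟩ k hk d
    cases k with
    | zero => simpa using h₀
    | succ k => simpa [List.ofFn_succ] using h (d 0) k (by omega) (fun j => d j.succ)

theorem VanishesToOrder.mono (h : VanishesToOrder n F v) (hmn : m ≤ n) :
    VanishesToOrder m F v := fun k hk => h k (by omega)

theorem VanishesToOrder.add (hF : VanishesToOrder m F v) (hG : VanishesToOrder m G v) :
    VanishesToOrder m (F + G) v := by
  induction m generalizing F G with
  | zero => exact vanishesToOrder_zero _ _
  | succ m ih =>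
    rw [vanishesToOrder_succ] at *
    exact ⟨by simp [hF.1, hG.1], fun i => by simpa using ih (hF.2 i) (hG.2 i)⟩

theorem VanishesToOrder.mul (hF : VanishesToOrder m F v) (hG : VanishesToOrder n G v) :
    VanishesToOrder (m + n) (F * G) v := by
  induction hk : m + n generalizing m n F G with
  | zero => exact vanishesToOrder_zero _ _
  | succ k ih =>
    rw [vanishesToOrder_succ]
    refine ⟨?_, fun i => ?_⟩
    · rcases m with _ | m
      · obtain ⟨n, rfl⟩ : ∃ l, n = l + 1 := ⟨k, by omega⟩
        simp [(vanishesToOrder_succ.1 hG).1]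
      · simp [(vanishesToOrder_succ.1 hF).1]
    · rw [pderiv_mul]
      refine VanishesToOrder.add ?_ ?_
      · rcases m with _ | m
        · exact ih (vanishesToOrder_zero _ _) (hG.mono (by omega : k ≤ n)) (by omega)
        · exact ih ((vanishesToOrder_succ.1 hF).2 i) hG (by omega)
      · rcases n with _ | n
        · exact ih (hF.mono (by omega : k ≤ m)) (vanishesToOrder_zero _ _) (by omega)
        · exact ih hF ((vanishesToOrder_succ.1 hG).2 i) (by omega)

theorem VanishesToOrder.pow (hF : VanishesToOrder m F v) (n : ℕ) :
    VanishesToOrder (n * m) (F ^ n) v := by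
  induction n with
  | zero => simpa using vanishesToOrder_zero _ _
  | succ n ih => simpa [pow_succ, add_mul] using ih.mul hF

theorem vanishesToOrder_one (h : eval v F = 0) : VanishesToOrder 1 F v :=
  vanishesToOrder_succ.2 ⟨h, fun _ => vanishesToOrder_zero _ _⟩

end VanishesToOrder

/-- The expansion of a polynomial along all lines through `v`: the substitution
`Xᵢ ↦ vᵢ + T Xᵢ`. -/
noncomputable def lineExpansion (v : Fin 3 → ℂ) :
    MvPolynomial (Fin 3) ℂ →ₐ[ℂ] Polynomial (MvPolynomial (Fin 3) ℂ) :=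
  aeval fun i => Polynomial.C (C (v i)) + Polynomial.X * Polynomial.C (X i)

/-- `F` has multiplicity at least `m` at `v`, expressed through expansions along lines. -/
def HasMult (m : ℕ) (F : MvPolynomial (Fin 3) ℂ) (v : Fin 3 → ℂ) : Prop :=
  Polynomial.X ^ m ∣ lineExpansion v F

theorem derivative_lineExpansion (v : Fin 3 → ℂ) (F : MvPolynomial (Fin 3) ℂ) :
    Polynomial.derivative (lineExpansion v F) =
      ∑ i, Polynomial.C (X i) * lineExpansion v (pderiv i F) := by
  induction F using MvPolynomial.induction_on with
  | C a =>
    have : lineExpansion v (C a) = Polynomial.C (C a) := by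
      simp [lineExpansion]
    simp [this]
  | add p q hp hq => simp [hp, hq, Finset.sum_add_distrib, mul_add]
  | mul_X p j hp =>
    have hX : lineExpansion v (X j) =
        Polynomial.C (C (v j)) + Polynomial.X * Polynomial.C (X j) := by
      simp [lineExpansion]
    have key : ∀ i, Polynomial.C (X i) * lineExpansion v (pderiv i (p * X j)) =
        Polynomial.C (X i) * lineExpansion v (pderiv i p) * lineExpansion v (X j) +
        (if i = j then Polynomial.C (X i) * lineExpansion v p else 0) := by
      intro i
      rw [pderiv_mul, map_add, map_mul, map_mul]
      by_cases h : i = j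
      · subst h; simp; ring
      · rw [pderiv_X_of_ne (Ne.symm h)]; simp [h]; ring
    simp_rw [key]
    rw [Finset.sum_add_distrib, ← Finset.sum_mul, ← hp, map_mul, Polynomial.derivative_mul, hX]
    simp; ring

theorem coeff_zero_lineExpansion (v : Fin 3 → ℂ) (F : MvPolynomial (Fin 3) ℂ) :
    (lineExpansion v F).coeff 0 = C (eval v F) := by
  rw [← Polynomial.constantCoeff_apply]
  induction F using MvPolynomial.induction_on with
  | C a => simp [lineExpansion]
  | add p q hp hq => simp only [map_add, hp, hq]
  | mul_X p j hp =>
    simp only [map_mul, hp, eval_X]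
    simp [lineExpansion]

theorem VanishesToOrder.hasMult {m : ℕ} {F : MvPolynomial (Fin 3) ℂ} {v : Fin 3 → ℂ}
    (h : VanishesToOrder m F v) : HasMult m F v := by
  induction m generalizing F with
  | zero => simp [HasMult]
  | succ m ih =>
    rw [vanishesToOrder_succ] at h
    have hd : Polynomial.X ^ m ∣ Polynomial.derivative (lineExpansion v F) := by
      rw [derivative_lineExpansion]
      exact Finset.dvd_sum fun i _ => Dvd.dvd.mul_left (ih (h.2 i)) _
    rw [HasMult, Polynomial.X_pow_dvd_iff]
    rw [Polynomial.X_pow_dvd_iff] at hd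
    rintro (_ | k) hk
    · simp [coeff_zero_lineExpansion, h.1]
    · have := hd k (by omega)
      rw [Polynomial.coeff_derivative] at this
      exact (mul_eq_zero.1 this).resolve_right (by exact_mod_cast Nat.succ_ne_zero k)

theorem aeval_mul_of_isHomogeneous {A : Type*} [CommRing A] [Algebra ℂ A] {d : ℕ}
    {F : MvPolynomial (Fin 3) ℂ} (hF : F.IsHomogeneous d) (c : A) (φ : Fin 3 → A) :
    aeval (fun i => c * φ i) F = c ^ d * aeval φ F := by
  rw [aeval_def, aeval_def, eval₂_eq', eval₂_eq', Finset.mul_sum]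
  refine Finset.sum_congr rfl fun x hx => ?_
  have hdeg : ∑ i, x i = d := by
    rw [← Finsupp.degree_eq_sum]
    exact (hF.degree_eq_sum_deg_support hx).symm
  simp_rw [mul_pow]
  rw [Finset.prod_mul_distrib, Finset.prod_pow_eq_pow_sum, hdeg]
  ring

/-- Multiplicities along a polynomial curve `φ` passing through a multiple of `v`. -/
theorem HasMult.pow_dvd_aeval {m d : ℕ} {F : MvPolynomial (Fin 3) ℂ} {v : Fin 3 → ℂ}
    (h : HasMult m F v) (hF : F.IsHomogeneous d) {φ : Fin 3 → Polynomial ℂ} {s c : ℂ}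
    (hc : c ≠ 0) (hφ : ∀ i, (φ i).eval s = c * v i) :
    (Polynomial.X - Polynomial.C s) ^ m ∣ aeval φ F := by
  have hroot : ∀ i, ∃ ψ, Polynomial.C c⁻¹ * φ i =
      Polynomial.C (v i) + (Polynomial.X - Polynomial.C s) * ψ := by
    intro i
    have : (Polynomial.X - Polynomial.C s) ∣ Polynomial.C c⁻¹ * φ i - Polynomial.C (v i) := by
      rw [Polynomial.dvd_iff_isRoot]
      simp [hφ, hc]
    obtain ⟨ψ, hψ⟩ := this
    exact ⟨ψ, by rw [← hψ]; ring⟩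
  choose ψ hψ using hroot
  have hscale : aeval (fun i => Polynomial.C c⁻¹ * φ i) F =
      Polynomial.C c⁻¹ ^ d * aeval φ F := aeval_mul_of_isHomogeneous hF _ _
  have hcomp : aeval (fun i => Polynomial.C c⁻¹ * φ i) F =
      Polynomial.eval₂ (aeval ψ : MvPolynomial (Fin 3) ℂ →ₐ[ℂ] Polynomial ℂ).toRingHom
        (Polynomial.X - Polynomial.C s) (lineExpansion v F) := by
    have : (aeval (fun i => Polynomial.C c⁻¹ * φ i) :
        MvPolynomial (Fin 3) ℂ →ₐ[ℂ] Polynomial ℂ).toRingHom =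
        (Polynomial.eval₂RingHom (aeval ψ : MvPolynomial (Fin 3) ℂ →ₐ[ℂ] Polynomial ℂ).toRingHom
          (Polynomial.X - Polynomial.C s)).comp (lineExpansion v).toRingHom := by
      refine MvPolynomial.ringHom_ext (fun r => ?_) (fun i => ?_)
      · simp [lineExpansion]
      · simp [lineExpansion, hψ, -Polynomial.X_mul_C]
    exact congrArg (fun f => f F) this
  have : (Polynomial.X - Polynomial.C s) ^ m ∣ Polynomial.C c⁻¹ ^ d * aeval φ F := by
    rw [← hscale, hcomp]
    obtain ⟨K, hK⟩ := h
    rw [hK, Polynomial.eval₂_mul, Polynomial.eval₂_X_pow]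
    exact dvd_mul_right _ _
  exact (IsUnit.dvd_mul_left ((Polynomial.isUnit_C.2 (by simp [hc])).pow d)).1 this

theorem HasMult.of_mul_of_eval_ne_zero {m : ℕ} {K G : MvPolynomial (Fin 3) ℂ} {v : Fin 3 → ℂ}
    (h : HasMult m (K * G) v) (hK : eval v K ≠ 0) : HasMult m G v := by
  rw [HasMult, map_mul] at h
  refine Polynomial.prime_X.pow_dvd_of_dvd_mul_left _ ?_ h
  rw [Polynomial.X_dvd_iff, coeff_zero_lineExpansion]
  simpa using hK

theorem HasMult.of_mul_of_not_hasMult_two {m : ℕ} {K G : MvPolynomial (Fin 3) ℂ}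
    {v : Fin 3 → ℂ} (h : HasMult m (K * G) v) (hK : ¬ HasMult 2 K v) : HasMult (m - 1) G v := by
  rcases m with _ | m
  · simp [HasMult]
  by_cases h0 : eval v K = 0
  · rw [HasMult, map_mul] at h
    obtain ⟨k, hk⟩ : Polynomial.X ∣ lineExpansion v K := by
      rw [Polynomial.X_dvd_iff, coeff_zero_lineExpansion, h0, C_0]
    have hk' : ¬ Polynomial.X ∣ k := fun ⟨l, hl⟩ => hK ⟨l, by rw [hk, hl]; ring⟩
    refine Polynomial.prime_X.pow_dvd_of_dvd_mul_left _ hk' ?_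
    rw [hk, pow_succ', mul_assoc] at h
    simpa using (mul_dvd_mul_iff_left Polynomial.X_ne_zero).1 h
  · exact dvd_trans (pow_dvd_pow _ (by omega)) (h.of_mul_of_eval_ne_zero h0)

theorem HasMult.eval_pderiv_eq_zero {K : MvPolynomial (Fin 3) ℂ} {v : Fin 3 → ℂ}
    (h : HasMult 2 K v) (i : Fin 3) : eval v (pderiv i K) = 0 := by
  rw [HasMult, Polynomial.X_pow_dvd_iff] at h
  have h1 := h 1 (by norm_num)
  have h2 : (Polynomial.derivative (lineExpansion v K)).coeff 0 = 0 := by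
    rw [Polynomial.coeff_derivative]; simp [h1]
  rw [derivative_lineExpansion, Polynomial.finsetSum_coeff] at h2
  simp only [Polynomial.coeff_C_mul, coeff_zero_lineExpansion] at h2
  have := congrArg (eval (Pi.single i 1)) h2
  simpa [Pi.single_apply] using this

theorem exists_homogeneous_cofactor {d e : ℕ} {F K : MvPolynomial (Fin 3) ℂ} (hF0 : F ≠ 0)
    (hF : F.IsHomogeneous d) (hK : K.IsHomogeneous e) (h : K ∣ F) :
    e ≤ d ∧ ∃ G, G ≠ 0 ∧ G.IsHomogeneous (d - e) ∧ F = K * G := by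
  classical
  let _ := MvPolynomial.gradedAlgebra (σ := Fin 3) (R := ℂ)
  obtain ⟨G, rfl⟩ := h
  have h1 := DirectSum.coe_decompose_mul_of_left_mem (homogeneousSubmodule (Fin 3) ℂ) (b := G) d
    ((mem_homogeneousSubmodule e K).2 hK)
  rw [DirectSum.decompose_of_mem_same _ ((mem_homogeneousSubmodule d _).2 hF)] at h1
  split_ifs at h1 with hed
  · refine ⟨hed, _, ?_, ?_, h1⟩
    · rintro h
      exact hF0 (by rw [h1, h, mul_zero])
    · exact (mem_homogeneousSubmodule _ _).1 (SetLike.coe_mem _)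
  · exact absurd h1 hF0

/-! ### Bézout bounds for rational curves -/

theorem eval_aeval (v : Fin 3 → ℂ) (f : Fin 3 → MvPolynomial (Fin 3) ℂ)
    (F : MvPolynomial (Fin 3) ℂ) : eval v (aeval f F) = eval (fun i => eval v (f i)) F := by
  simp only [← coe_aeval_eq_eval, RingHom.coe_coe]
  exact comp_aeval_apply f (aeval v) F

theorem polynomial_eval_aeval (s : ℂ) (φ : Fin 3 → Polynomial ℂ) (F : MvPolynomial (Fin 3) ℂ) :
    (aeval φ F).eval s = eval (fun i => (φ i).eval s) F := by
  simp only [← coe_aeval_eq_eval, RingHom.coe_coe, ← Polynomial.coe_aeval_eq_eval]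
  exact comp_aeval_apply φ ((Polynomial.aeval s).restrictScalars ℂ) F

theorem sum_le_natDegree_of_pow_dvd {n : ℕ} {f : Polynomial ℂ} (hf : f ≠ 0) {s : Fin n → ℂ}
    (hs : Function.Injective s) {m : Fin n → ℕ}
    (h : ∀ i, (Polynomial.X - Polynomial.C (s i)) ^ m i ∣ f) : ∑ i, m i ≤ f.natDegree := by
  have hdvd : ∏ i, (Polynomial.X - Polynomial.C (s i)) ^ m i ∣ f :=
    Finset.prod_dvd_of_coprime
      (fun i _ j _ hij => (Polynomial.pairwise_coprime_X_sub_C hs hij).pow) fun i _ => h i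
  have := Polynomial.natDegree_le_of_dvd hdvd hf
  rw [Polynomial.natDegree_prod _ _ fun i _ => pow_ne_zero _ (Polynomial.X_sub_C_ne_zero _)]
    at this
  simpa using this

theorem sum_mult_le_of_aeval_ne_zero {n d e : ℕ} {F : MvPolynomial (Fin 3) ℂ}
    (hF : F.IsHomogeneous d) {φ : Fin 3 → Polynomial ℂ} (hφ : ∀ i, (φ i).natDegree ≤ e)
    (hne : aeval φ F ≠ 0) {s c : Fin n → ℂ} (hs : Function.Injective s) (hc : ∀ i, c i ≠ 0)
    {v : Fin n → Fin 3 → ℂ} (hv : ∀ i j, (φ j).eval (s i) = c i * v i j) {m : Fin n → ℕ}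
    (h : ∀ i, HasMult (m i) F (v i)) : ∑ i, m i ≤ d * e :=
  (sum_le_natDegree_of_pow_dvd hne hs fun i => (h i).pow_dvd_aeval hF (hc i) (hv i)).trans
    (aeval_natDegree_le F hF.totalDegree_le φ hφ)

theorem eq_zero_of_eval_eq_zero_of_linear_eq_one {e : ℕ} {H M : MvPolynomial (Fin 3) ℂ}
    (hH : H.IsHomogeneous e) (hM : M.IsHomogeneous 1) (hM0 : M ≠ 0)
    (h : ∀ v, eval v M = 1 → eval v H = 0) : H = 0 := by
  refine (mul_eq_zero.1 (MvPolynomial.funext (p := M * H) (q := 0) fun v => ?_)).resolve_left hM0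
  rw [map_mul, map_zero]
  by_cases hv : eval v M = 0
  · rw [hv, zero_mul]
  have hscale : ∀ {k : ℕ} {G : MvPolynomial (Fin 3) ℂ}, G.IsHomogeneous k →
      eval (fun i => (eval v M)⁻¹ * v i) G = (eval v M)⁻¹ ^ k * eval v G := fun hG => by
    simpa [coe_aeval_eq_eval] using aeval_mul_of_isHomogeneous hG (eval v M)⁻¹ v
  have := h _ (by rw [hscale hM, pow_one, inv_mul_cancel₀ hv])
  rw [hscale hH] at this
  rw [(mul_eq_zero.1 this).resolve_left (pow_ne_zero _ (inv_ne_zero hv)), mul_zero]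

theorem dvd_aeval_sub_aeval {A : Type*} [CommRing A] [Algebra ℂ A] {K : A} {f g : Fin 3 → A}
    (h : ∀ i, K ∣ f i - g i) (F : MvPolynomial (Fin 3) ℂ) : K ∣ aeval f F - aeval g F := by
  induction F using MvPolynomial.induction_on with
  | C a => simp
  | add p q hp hq =>
    rw [map_add, map_add, add_sub_add_comm]
    exact dvd_add hp hq
  | mul_X p j hp =>
    rw [map_mul, map_mul, aeval_X, aeval_X,
      show aeval f p * f j - aeval g p * g j =
        (aeval f p - aeval g p) * f j + aeval g p * (f j - g j) by ring]
    exact dvd_add (hp.mul_right _) ((h j).mul_left _)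

/-! ### The normalised configuration -/

/-- The line through the five collinear points, in normalised coordinates. -/
noncomputable def unitLine : MvPolynomial (Fin 3) ℂ := X 0 + X 1 + X 2

/-- A conic through the three coordinate points. -/
noncomputable def coordConic (β γ : ℂ) : MvPolynomial (Fin 3) ℂ :=
  X 1 * X 2 + C β * X 0 * X 2 + C γ * X 0 * X 1

theorem isHomogeneous_unitLine : unitLine.IsHomogeneous 1 :=
  ((isHomogeneous_X _ _).add (isHomogeneous_X _ _)).add (isHomogeneous_X _ _)

theorem isHomogeneous_coordConic (β γ : ℂ) : (coordConic β γ).IsHomogeneous 2 :=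
  (((isHomogeneous_X _ _).mul (isHomogeneous_X _ _)).add
    ((isHomogeneous_C_mul_X _ _).mul (isHomogeneous_X _ _))).add
    ((isHomogeneous_C_mul_X _ _).mul (isHomogeneous_X _ _))

theorem unitLine_dvd_of_aeval_eq_zero {d : ℕ} {F : MvPolynomial (Fin 3) ℂ}
    (hF : F.IsHomogeneous d)
    (h : aeval ![1, Polynomial.X, -1 - Polynomial.X] F = (0 : Polynomial ℂ)) : unitLine ∣ F := by
  set H : MvPolynomial (Fin 3) ℂ := aeval ![X 0, X 1, -X 0 - X 1] F with hH
  have hhom : H.IsHomogeneous (1 * d) := by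
    refine hF.aeval _ fun i => ?_
    fin_cases i
    exacts [isHomogeneous_X _ _, isHomogeneous_X _ _,
      (isHomogeneous_X _ _).neg.sub (isHomogeneous_X _ _)]
  have hH0 : H = 0 := by
    refine eq_zero_of_eval_eq_zero_of_linear_eq_one hhom (isHomogeneous_X ℂ 0) (X_ne_zero _)
      fun v hv => ?_
    have h1 := congrArg (Polynomial.eval (v 1)) h
    rw [polynomial_eval_aeval, Polynomial.eval_zero] at h1
    rw [hH, eval_aeval]
    rw [eval_X] at hv
    rw [← h1]
    congr 2 with i
    fin_cases i <;> simp [hv]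
  have := dvd_aeval_sub_aeval (K := unitLine) (f := X) (g := ![X 0, X 1, -X 0 - X 1])
    (fun i => by fin_cases i <;> simp [unitLine]; exact ⟨1, by ring⟩) F
  rwa [← hH, hH0, sub_zero, aeval_X_left_apply] at this

theorem X_zero_dvd_of_aeval_eq_zero {d : ℕ} {F : MvPolynomial (Fin 3) ℂ}
    (hF : F.IsHomogeneous d)
    (h : aeval ![0, Polynomial.X, 1 - Polynomial.X] F = (0 : Polynomial ℂ)) : X 0 ∣ F := by
  set H : MvPolynomial (Fin 3) ℂ := aeval ![0, X 1, X 2] F with hH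
  have hhom : H.IsHomogeneous (1 * d) := by
    refine hF.aeval _ fun i => ?_
    fin_cases i
    exacts [isHomogeneous_zero _ _ _, isHomogeneous_X _ _, isHomogeneous_X _ _]
  have hH0 : H = 0 := by
    refine eq_zero_of_eval_eq_zero_of_linear_eq_one (M := X 1 + X 2) hhom
      ((isHomogeneous_X ℂ _).add (isHomogeneous_X ℂ _)) (fun h => ?_) fun v hv => ?_
    · simpa using congrArg (eval ![0, 1, 0]) h
    have h1 := congrArg (Polynomial.eval (v 1)) h
    rw [polynomial_eval_aeval, Polynomial.eval_zero] at h1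
    rw [hH, eval_aeval]
    have hv' : v 2 = 1 - v 1 := by rw [← hv]; simp
    rw [← h1]
    congr 2 with i
    fin_cases i <;> simp [hv']
  have := dvd_aeval_sub_aeval (K := (X 0 : MvPolynomial (Fin 3) ℂ)) (f := X) (g := ![0, X 1, X 2])
    (fun i => by fin_cases i <;> simp) F
  rwa [← hH, hH0, sub_zero, aeval_X_left_apply] at this

/-- A parametrisation of `coordConic β γ`, for any choice of the parameter `τ`, which determines
the point at infinity. -/
noncomputable def conicParam (β γ τ : ℂ) : Fin 3 → Polynomial ℂ :=
  let z := Polynomial.C τ * Polynomial.X + 1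
  let g := Polynomial.C β * z + Polynomial.C γ * Polynomial.X
  ![-(Polynomial.X * z), g * Polynomial.X, g * z]

theorem natDegree_conicParam_le (β γ τ : ℂ) (i : Fin 3) : (conicParam β γ τ i).natDegree ≤ 2 := by
  fin_cases i <;> simp only [conicParam, Fin.mk_one, Fin.zero_eta, Fin.reduceFinMk,
    Matrix.cons_val] <;> compute_degree

theorem coordConic_dvd_of_aeval_eq_zero {d : ℕ} {F : MvPolynomial (Fin 3) ℂ}
    (hF : F.IsHomogeneous d) {β γ τ : ℂ} (hβ : β ≠ 0) (hγ : γ ≠ 0)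
    (h : aeval (conicParam β γ τ) F = 0) : coordConic β γ ∣ F := by
  set g : MvPolynomial (Fin 3) ℂ := C β * X 2 + C γ * X 1 with hg
  set H : MvPolynomial (Fin 3) ℂ := aeval ![-(X 1 * X 2), g * X 1, g * X 2] F with hH
  have hghom : g.IsHomogeneous 1 := (isHomogeneous_C_mul_X _ _).add (isHomogeneous_C_mul_X _ _)
  have hhom : H.IsHomogeneous (2 * d) := by
    refine hF.aeval _ fun i => ?_
    fin_cases i
    exacts [((isHomogeneous_X _ _).mul (isHomogeneous_X _ _)).neg,
      hghom.mul (isHomogeneous_X _ _), hghom.mul (isHomogeneous_X _ _)]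
  have hH0 : H = 0 := by
    refine eq_zero_of_eval_eq_zero_of_linear_eq_one (M := X 2 - C τ * X 1) hhom
      ((isHomogeneous_X ℂ _).sub (isHomogeneous_C_mul_X _ _)) (fun h => ?_) fun v hv => ?_
    · simpa using congrArg (eval ![0, 0, 1]) h
    have h1 := congrArg (Polynomial.eval (v 1)) h
    rw [polynomial_eval_aeval, Polynomial.eval_zero] at h1
    rw [hH, eval_aeval]
    have hv' : v 2 = τ * v 1 + 1 := by rw [← hv]; simp
    rw [← h1]
    congr 2 with i
    fin_cases i <;> simp [hv', conicParam, hg]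
  have hdvd := dvd_aeval_sub_aeval (K := coordConic β γ) (f := fun i => g * X i)
    (g := ![-(X 1 * X 2), g * X 1, g * X 2])
    (fun i => by fin_cases i <;> simp [coordConic, hg]; exact ⟨1, by ring⟩) F
  rw [← hH, hH0, sub_zero, aeval_mul_of_isHomogeneous hF, aeval_X_left_apply] at hdvd
  have hX : ∀ {i : Fin 3}, (∃ v : Fin 3 → ℂ, v i = 0 ∧ eval v g ≠ 0) → IsRelPrime g (X i) := by
    rintro i ⟨v, hv, hgv⟩
    refine IsRelPrime.symm ((X_prime (R := ℂ)).irreducible.isRelPrime_iff_not_dvd.2 ?_)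
    rintro ⟨k, hk⟩
    exact hgv (by rw [hk]; simp [hv])
  have hrel : IsRelPrime (coordConic β γ) g := by
    have h12 : IsRelPrime g (X 1 * X 2) :=
      (hX ⟨![0, 0, 1], by simp, by simpa [hg] using hβ⟩).mul_right
        (hX ⟨![0, 1, 0], by simp, by simpa [hg] using hγ⟩)
    intro k hk hkg
    refine h12 hkg ?_
    have : X 1 * X 2 = coordConic β γ - g * X 0 := by rw [coordConic, hg]; ring
    rw [this]
    exact dvd_sub hk (hkg.mul_right _)
  exact IsRelPrime.dvd_of_dvd_mul_left hrel.pow_right hdvd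

theorem mult_le_of_not_unitLine_dvd {d : ℕ} {F : MvPolynomial (Fin 3) ℂ} (hF : F.IsHomogeneous d)
    (hne : ¬ unitLine ∣ F) {n : ℕ} {t : Fin n → ℂ} (ht : Function.Injective t) {m : Fin n → ℕ}
    (h : ∀ i, HasMult (m i) F ![1, t i, -1 - t i]) : ∑ i, m i ≤ d := by
  have := sum_mult_le_of_aeval_ne_zero (e := 1) hF
    (φ := ![1, Polynomial.X, -1 - Polynomial.X]) (fun i => ?_)
    (fun h0 => hne (unitLine_dvd_of_aeval_eq_zero hF h0)) ht (c := fun _ => 1) (by simp)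
    (fun i j => ?_) h
  · simpa using this
  · fin_cases i <;> simp only [Fin.mk_one, Fin.zero_eta, Fin.reduceFinMk, Matrix.cons_val] <;>
      compute_degree!
  · fin_cases j <;> simp

theorem mult_le_of_not_X_zero_dvd {d a b : ℕ} {F : MvPolynomial (Fin 3) ℂ}
    (hF : F.IsHomogeneous d) (hne : ¬ X 0 ∣ F)
    (ha : HasMult a F ![0, 1, 0]) (hb : HasMult b F ![0, 0, 1]) : a + b ≤ d := by
  have := sum_mult_le_of_aeval_ne_zero (e := 1) hF
    (φ := ![0, Polynomial.X, 1 - Polynomial.X]) (fun i => ?_)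
    (fun h0 => hne (X_zero_dvd_of_aeval_eq_zero hF h0)) (s := ![1, 0]) ?_ (c := fun _ => 1)
    (by simp) (v := ![![0, 1, 0], ![0, 0, 1]]) (m := ![a, b]) (fun i j => ?_) (fun i => ?_)
  · simpa using this
  · fin_cases i <;> simp only [Fin.mk_one, Fin.zero_eta, Fin.reduceFinMk, Matrix.cons_val] <;>
      compute_degree!
  · simp [Function.Injective, Fin.forall_fin_succ]
  · fin_cases i <;> fin_cases j <;> simp
  · fin_cases i
    exacts [ha, hb]

/-- The conic through the coordinate points and the points `(1, t, -1 - t)`, `(1, u, -1 - u)`. -/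
noncomputable def pairConic (t u : ℂ) : MvPolynomial (Fin 3) ℂ :=
  coordConic (t * u) ((1 + t) * (1 + u))

theorem mult_le_of_not_pairConic_dvd {d p a b r q : ℕ} {F : MvPolynomial (Fin 3) ℂ}
    (hF : F.IsHomogeneous d) {t u : ℂ} (ht0 : t ≠ 0) (ht1 : 1 + t ≠ 0) (hu0 : u ≠ 0)
    (hu1 : 1 + u ≠ 0) (htu : t ≠ u) (hne : ¬ pairConic t u ∣ F)
    (hp : HasMult p F ![1, 0, 0]) (ha : HasMult a F ![0, 1, 0]) (hb : HasMult b F ![0, 0, 1])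
    (hr : HasMult r F ![1, t, -1 - t]) (hq : HasMult q F ![1, u, -1 - u]) :
    p + a + b + r + q ≤ d * 2 := by
  obtain ⟨ρ, hρ⟩ : ∃ ρ, ρ = -(1 + t) / t := ⟨_, rfl⟩
  obtain ⟨σ, hσ⟩ : ∃ σ, σ = -(1 + u) / u := ⟨_, rfl⟩
  have hρ0 : ρ ≠ 0 := by rw [hρ]; exact div_ne_zero (neg_ne_zero.2 ht1) ht0
  have hσ0 : σ ≠ 0 := by rw [hσ]; exact div_ne_zero (neg_ne_zero.2 hu1) hu0
  have hρt : ρ * t = -(1 + t) := by rw [hρ]; field_simp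
  have hσu : σ * u = -(1 + u) := by rw [hσ]; field_simp
  have hρ1 : ρ + 1 ≠ 0 := fun h => by
    have : ρ = -1 := by linear_combination h
    rw [this] at hρt; exact one_ne_zero (by linear_combination hρt : (1 : ℂ) = 0)
  have hσ1 : σ + 1 ≠ 0 := fun h => by
    have : σ = -1 := by linear_combination h
    rw [this] at hσu; exact one_ne_zero (by linear_combination hσu : (1 : ℂ) = 0)
  have hρσ : ρ ≠ σ := fun h => by
    rw [← h] at hσu
    have : (ρ + 1) * (t - u) = 0 := by linear_combination hρt - hσu
    exact (mul_ne_zero hρ1 (sub_ne_zero.2 htu)) this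
  obtain ⟨τ, hτ⟩ := Finset.exists_notMem ({0, -(ρ * σ), ρ, σ} : Finset ℂ)
  simp only [Finset.mem_insert, Finset.mem_singleton, not_or] at hτ
  obtain ⟨hτ0, hτp, hτρ, hτσ⟩ := hτ
  have e0 : 0 - τ ≠ 0 := sub_ne_zero.2 (Ne.symm hτ0)
  have ep : -(ρ * σ) - τ ≠ 0 := sub_ne_zero.2 (Ne.symm hτp)
  have eρ : ρ - τ ≠ 0 := sub_ne_zero.2 (Ne.symm hτρ)
  have eσ : σ - τ ≠ 0 := sub_ne_zero.2 (Ne.symm hτσ)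
  have hγ : (1 + t) * (1 + u) = ρ * σ * (t * u) := by
    linear_combination (1 + u) * hρt - ρ * t * hσu
  have hβ : t * u ≠ 0 := mul_ne_zero ht0 hu0
  have hγ0 : (1 + t) * (1 + u) ≠ 0 := mul_ne_zero ht1 hu1
  -- the value of the parametrisation at a finite slope `κ`
  have hval : ∀ κ, κ - τ ≠ 0 → ∀ j,
      (conicParam (t * u) ((1 + t) * (1 + u)) τ j).eval (κ - τ)⁻¹ =
        (κ - τ)⁻¹ ^ 2 * (![-κ, t * u * (κ + ρ * σ), t * u * (κ + ρ * σ) * κ] : Fin 3 → ℂ) j := by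
    intro κ hκ j
    have hz : τ * (κ - τ)⁻¹ + 1 = κ * (κ - τ)⁻¹ := by field_simp; ring
    rw [hγ]
    generalize (κ - τ)⁻¹ = s at hz ⊢
    fin_cases j <;> simp [conicParam, hz] <;> ring
  have := sum_mult_le_of_aeval_ne_zero (e := 2) hF
    (natDegree_conicParam_le (t * u) ((1 + t) * (1 + u)) τ)
    (fun h0 => hne (coordConic_dvd_of_aeval_eq_zero hF hβ hγ0 h0))
    (s := ![(-(ρ * σ) - τ)⁻¹, (0 - τ)⁻¹, 0, (ρ - τ)⁻¹, (σ - τ)⁻¹]) ?_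
    (c := ![(-(ρ * σ) - τ)⁻¹ ^ 2 * (ρ * σ), (0 - τ)⁻¹ ^ 2 * (t * u * (ρ * σ)), t * u,
      (ρ - τ)⁻¹ ^ 2 * (-ρ), (σ - τ)⁻¹ ^ 2 * (-σ)]) ?_
    (v := ![![1, 0, 0], ![0, 1, 0], ![0, 0, 1], ![1, t, -1 - t], ![1, u, -1 - u]])
    (m := ![p, a, b, r, q]) (fun i j => ?_) (fun i => ?_)
  · simpa [Fin.sum_univ_succ, ← add_assoc] using this
  · have hd1 : -(ρ * σ) ≠ ρ := fun h => mul_ne_zero hρ0 hσ1 (by linear_combination -h)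
    have hd2 : -(ρ * σ) ≠ σ := fun h => mul_ne_zero hσ0 hρ1 (by linear_combination -h)
    have hd0 : -(ρ * σ) ≠ 0 := neg_ne_zero.2 (mul_ne_zero hρ0 hσ0)
    have hinj : ∀ {κ κ' : ℂ}, κ ≠ κ' → (κ - τ)⁻¹ ≠ (κ' - τ)⁻¹ := fun h h' =>
      h (sub_left_injective (inv_injective h'))
    simp only [Function.Injective, Fin.forall_fin_succ]
    simp [-zero_sub, hinj hd1, hinj hd2, hinj hd0, hinj hρσ, hinj hρ0, hinj hσ0,
      (hinj hd1).symm, (hinj hd2).symm, (hinj hd0).symm, (hinj hρσ).symm, (hinj hρ0).symm,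
      (hinj hσ0).symm, e0, ep, eρ, eσ, (inv_ne_zero e0).symm, (inv_ne_zero ep).symm, (inv_ne_zero eρ).symm,
      (inv_ne_zero eσ).symm]
  · intro i
    fin_cases i
    exacts [mul_ne_zero (pow_ne_zero _ (inv_ne_zero ep)) (mul_ne_zero hρ0 hσ0),
      mul_ne_zero (pow_ne_zero _ (inv_ne_zero e0)) (mul_ne_zero hβ (mul_ne_zero hρ0 hσ0)), hβ,
      mul_ne_zero (pow_ne_zero _ (inv_ne_zero eρ)) (neg_ne_zero.2 hρ0),
      mul_ne_zero (pow_ne_zero _ (inv_ne_zero eσ)) (neg_ne_zero.2 hσ0)]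
  · fin_cases i
    · refine (hval _ ep j).trans ?_
      fin_cases j <;> simp
    · refine (hval _ e0 j).trans ?_
      fin_cases j <;> simp
    · fin_cases j <;> simp [conicParam]
    · refine (hval _ eρ j).trans ?_
      have h1 : t * u * (ρ + ρ * σ) = -ρ * t := by linear_combination t * ρ * hσu
      fin_cases j <;> simp [h1]
      · ring
      · linear_combination ((ρ - τ) ^ 2)⁻¹ * ρ * hρt
    · refine (hval _ eσ j).trans ?_
      have h1 : t * u * (σ + ρ * σ) = -σ * u := by linear_combination u * σ * hρt
      fin_cases j <;> simp [h1]
      · ring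
      · linear_combination ((σ - τ) ^ 2)⁻¹ * σ * hσu
  · fin_cases i
    exacts [hp, ha, hb, hr, hq]

theorem not_hasMult_two_pairConic {t u : ℂ} {v : Fin 3 → ℂ} (i : Fin 3)
    (h : eval v (pderiv i (pairConic t u)) ≠ 0) : ¬ HasMult 2 (pairConic t u) v :=
  fun hm => h (hm.eval_pderiv_eq_zero i)

/-- The intersection inequality with the nef class that governs the configuration. -/
theorem weighted_mult_le {t₁ t₂ t₃ : ℂ} (h10 : t₁ ≠ 0) (h11 : 1 + t₁ ≠ 0) (h20 : t₂ ≠ 0)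
    (h21 : 1 + t₂ ≠ 0) (h30 : t₃ ≠ 0) (h31 : 1 + t₃ ≠ 0) (h12 : t₁ ≠ t₂) (h13 : t₁ ≠ t₃)
    (h23 : t₂ ≠ t₃) (d : ℕ) {F : MvPolynomial (Fin 3) ℂ} (hF0 : F ≠ 0) (hF : F.IsHomogeneous d)
    {p a b x y r₁ r₂ r₃ : ℕ}
    (hp : HasMult p F ![1, 0, 0]) (ha : HasMult a F ![0, 1, 0]) (hb : HasMult b F ![0, 0, 1])
    (hx : HasMult x F ![1, -1, -1 - -1]) (hy : HasMult y F ![1, 0, -1 - 0])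
    (hr₁ : HasMult r₁ F ![1, t₁, -1 - t₁]) (hr₂ : HasMult r₂ F ![1, t₂, -1 - t₂])
    (hr₃ : HasMult r₃ F ![1, t₃, -1 - t₃]) :
    6 * p + 7 * a + 7 * b + x + y + 4 * (r₁ + r₂ + r₃) ≤ 14 * d := by
  induction d using Nat.strong_induction_on generalizing F p a b x y r₁ r₂ r₃ with
  | _ d ih =>
    have evalLine : ∀ t u s : ℂ,
        eval ![1, s, -1 - s] (pairConic t u) = -((s - t) * (s - u)) := fun t u s => by
      simp [pairConic, coordConic]; ring
    have ne : ∀ {t u s : ℂ}, s ≠ t → s ≠ u → eval ![1, s, -1 - s] (pairConic t u) ≠ 0 :=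
      fun h h' => by
        rw [evalLine]
        exact neg_ne_zero.2 (mul_ne_zero (sub_ne_zero.2 h) (sub_ne_zero.2 h'))
    have neg_one_ne : ∀ {t : ℂ}, 1 + t ≠ 0 → -1 ≠ t := fun h h' => h (by rw [← h']; ring)
    have hm_p : ∀ {t u : ℂ}, t ≠ 0 → u ≠ 0 → ¬ HasMult 2 (pairConic t u) ![1, 0, 0] :=
      fun h h' => not_hasMult_two_pairConic 2 (by
        simpa [pairConic, coordConic, pderiv_X, Pi.single_apply] using ⟨h, h'⟩)
    have hm_a : ∀ t u : ℂ, ¬ HasMult 2 (pairConic t u) ![0, 1, 0] :=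
      fun t u => not_hasMult_two_pairConic 2 (by
        simp [pairConic, coordConic, pderiv_X])
    have hm_b : ∀ t u : ℂ, ¬ HasMult 2 (pairConic t u) ![0, 0, 1] :=
      fun t u => not_hasMult_two_pairConic 1 (by
        simp [pairConic, coordConic, pderiv_X])
    have hm_r : ∀ {t u : ℂ}, t ≠ 0 → 1 + t ≠ 0 →
        ¬ HasMult 2 (pairConic t u) ![1, t, -1 - t] := fun {t u} h h' =>
      not_hasMult_two_pairConic 0 (by
        have : eval ![1, t, -1 - t] (pderiv 0 (pairConic t u)) = t * (1 + t) := by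
          simp [pairConic, coordConic, pderiv_X]; ring
        rw [this]; exact mul_ne_zero h h')
    have hm_r' : ∀ {t u : ℂ}, u ≠ 0 → 1 + u ≠ 0 →
        ¬ HasMult 2 (pairConic t u) ![1, u, -1 - u] := fun {t u} h h' => by
      rw [show pairConic t u = pairConic u t by
        rw [pairConic, pairConic, mul_comm t, mul_comm (1 + t)]]
      exact hm_r h h'
    by_cases hL : unitLine ∣ F
    · obtain ⟨hd, G, hG0, hG, rfl⟩ :=
        exists_homogeneous_cofactor hF0 hF isHomogeneous_unitLine hL
      have hml : ∀ v : Fin 3 → ℂ, ¬ HasMult 2 unitLine v := fun v h => by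
        simpa [unitLine, pderiv_X, Pi.single_apply] using h.eval_pderiv_eq_zero 0
      have := ih (d - 1) (by omega) hG0 hG
        (hp.of_mul_of_eval_ne_zero (by simp [unitLine]))
        (ha.of_mul_of_eval_ne_zero (by simp [unitLine]))
        (hb.of_mul_of_eval_ne_zero (by simp [unitLine]))
        (hx.of_mul_of_not_hasMult_two (hml _)) (hy.of_mul_of_not_hasMult_two (hml _))
        (hr₁.of_mul_of_not_hasMult_two (hml _)) (hr₂.of_mul_of_not_hasMult_two (hml _))
        (hr₃.of_mul_of_not_hasMult_two (hml _))
      omega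
    by_cases hX : X 0 ∣ F
    · obtain ⟨hd, G, hG0, hG, rfl⟩ :=
        exists_homogeneous_cofactor hF0 hF (isHomogeneous_X _ _) hX
      have hml : ∀ v : Fin 3 → ℂ, ¬ HasMult 2 (X 0) v := fun v h => by
        simpa [pderiv_X, Pi.single_apply] using h.eval_pderiv_eq_zero 0
      have := ih (d - 1) (by omega) hG0 hG
        (hp.of_mul_of_eval_ne_zero (by simp))
        (ha.of_mul_of_not_hasMult_two (hml _)) (hb.of_mul_of_not_hasMult_two (hml _))
        (hx.of_mul_of_eval_ne_zero (by simp)) (hy.of_mul_of_eval_ne_zero (by simp))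
        (hr₁.of_mul_of_eval_ne_zero (by simp)) (hr₂.of_mul_of_eval_ne_zero (by simp))
        (hr₃.of_mul_of_eval_ne_zero (by simp))
      omega
    by_cases hC12 : pairConic t₁ t₂ ∣ F
    · obtain ⟨hd, G, hG0, hG, rfl⟩ :=
        exists_homogeneous_cofactor hF0 hF (isHomogeneous_coordConic _ _) hC12
      have := ih (d - 2) (by omega) hG0 hG
        (hp.of_mul_of_not_hasMult_two (hm_p h10 h20)) (ha.of_mul_of_not_hasMult_two (hm_a _ _))
        (hb.of_mul_of_not_hasMult_two (hm_b _ _))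
        (hx.of_mul_of_eval_ne_zero (ne (neg_one_ne h11) (neg_one_ne h21)))
        (hy.of_mul_of_eval_ne_zero (ne h10.symm h20.symm))
        (hr₁.of_mul_of_not_hasMult_two (hm_r h10 h11))
        (hr₂.of_mul_of_not_hasMult_two (hm_r' h20 h21))
        (hr₃.of_mul_of_eval_ne_zero (ne h13.symm h23.symm))
      omega
    by_cases hC13 : pairConic t₁ t₃ ∣ F
    · obtain ⟨hd, G, hG0, hG, rfl⟩ :=
        exists_homogeneous_cofactor hF0 hF (isHomogeneous_coordConic _ _) hC13
      have := ih (d - 2) (by omega) hG0 hG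
        (hp.of_mul_of_not_hasMult_two (hm_p h10 h30)) (ha.of_mul_of_not_hasMult_two (hm_a _ _))
        (hb.of_mul_of_not_hasMult_two (hm_b _ _))
        (hx.of_mul_of_eval_ne_zero (ne (neg_one_ne h11) (neg_one_ne h31)))
        (hy.of_mul_of_eval_ne_zero (ne h10.symm h30.symm))
        (hr₁.of_mul_of_not_hasMult_two (hm_r h10 h11))
        (hr₂.of_mul_of_eval_ne_zero (ne h12.symm h23))
        (hr₃.of_mul_of_not_hasMult_two (hm_r' h30 h31))
      omega
    by_cases hC23 : pairConic t₂ t₃ ∣ F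
    · obtain ⟨hd, G, hG0, hG, rfl⟩ :=
        exists_homogeneous_cofactor hF0 hF (isHomogeneous_coordConic _ _) hC23
      have := ih (d - 2) (by omega) hG0 hG
        (hp.of_mul_of_not_hasMult_two (hm_p h20 h30)) (ha.of_mul_of_not_hasMult_two (hm_a _ _))
        (hb.of_mul_of_not_hasMult_two (hm_b _ _))
        (hx.of_mul_of_eval_ne_zero (ne (neg_one_ne h21) (neg_one_ne h31)))
        (hy.of_mul_of_eval_ne_zero (ne h20.symm h30.symm))
        (hr₁.of_mul_of_eval_ne_zero (ne h12 h13))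
        (hr₂.of_mul_of_not_hasMult_two (hm_r h20 h21))
        (hr₃.of_mul_of_not_hasMult_two (hm_r' h30 h31))
      omega
    have b12 := mult_le_of_not_pairConic_dvd hF h10 h11 h20 h21 h12 hC12 hp ha hb hr₁ hr₂
    have b13 := mult_le_of_not_pairConic_dvd hF h10 h11 h30 h31 h13 hC13 hp ha hb hr₁ hr₃
    have b23 := mult_le_of_not_pairConic_dvd hF h20 h21 h30 h31 h23 hC23 hp ha hb hr₂ hr₃
    have bX := mult_le_of_not_X_zero_dvd hF hX ha hb
    have bL := mult_le_of_not_unitLine_dvd hF hL (t := ![-1, 0, t₁, t₂, t₃])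
      (m := ![x, y, r₁, r₂, r₃]) (by
        simp only [Function.Injective, Fin.forall_fin_succ]
        simp [h10, h20, h30, h12, h13, h23, h10.symm, h20.symm, h30.symm, h12.symm, h13.symm,
          h23.symm, neg_one_ne h11, neg_one_ne h21, neg_one_ne h31, (neg_one_ne h11).symm,
          (neg_one_ne h21).symm, (neg_one_ne h31).symm]) (fun i => by
        fin_cases i
        exacts [hx, hy, hr₁, hr₂, hr₃])
    simp only [Fin.sum_univ_succ, Finset.univ_eq_empty, Finset.sum_empty, Matrix.cons_val_zero,
      Matrix.cons_val_succ] at bL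
    omega

/-! ### Linear changes of coordinates -/

section Substitution

open Matrix

/-- The substitution of the linear forms given by the rows of `M` for the variables. -/
noncomputable def matrixSubst (M : Matrix (Fin 3) (Fin 3) ℂ) :
    MvPolynomial (Fin 3) ℂ →ₐ[ℂ] MvPolynomial (Fin 3) ℂ :=
  aeval fun i => ∑ j, C (M i j) * X j

theorem eval_matrixSubst (M : Matrix (Fin 3) (Fin 3) ℂ) (v : Fin 3 → ℂ)
    (F : MvPolynomial (Fin 3) ℂ) : eval v (matrixSubst M F) = eval (M *ᵥ v) F := by
  rw [matrixSubst, eval_aeval]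
  congr 2
  funext i
  simp [mulVec, dotProduct]

theorem isHomogeneous_matrixSubst (M : Matrix (Fin 3) (Fin 3) ℂ) {d : ℕ}
    {F : MvPolynomial (Fin 3) ℂ} (hF : F.IsHomogeneous d) :
    (matrixSubst M F).IsHomogeneous d := by
  have := hF.aeval (fun i => ∑ j, C (M i j) * X j) (n := 1) fun i =>
    IsHomogeneous.sum _ _ _ fun j _ => by
      simpa using (isHomogeneous_C (Fin 3) (M i j)).mul (isHomogeneous_X ℂ j)
  simpa [matrixSubst] using this

theorem matrixSubst_ne_zero {M N : Matrix (Fin 3) (Fin 3) ℂ} (h : M * N = 1)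
    {F : MvPolynomial (Fin 3) ℂ} (hF : F ≠ 0) : matrixSubst M F ≠ 0 := by
  intro h0
  refine hF (MvPolynomial.funext fun v => ?_)
  have := congrArg (eval (N *ᵥ v)) h0
  simpa [eval_matrixSubst, mulVec_mulVec, h] using this

theorem HasMult.matrixSubst (M : Matrix (Fin 3) (Fin 3) ℂ) {m : ℕ} {v : Fin 3 → ℂ}
    {F : MvPolynomial (Fin 3) ℂ} (h : HasMult m F (M *ᵥ v)) : HasMult m (matrixSubst M F) v := by
  have key : (lineExpansion v).toRingHom.comp (_root_.matrixSubst M).toRingHom =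
      (Polynomial.mapRingHom (_root_.matrixSubst M).toRingHom).comp
        (lineExpansion (M *ᵥ v)).toRingHom := by
    refine MvPolynomial.ringHom_ext (fun r => ?_) (fun i => ?_)
    · simp [lineExpansion, _root_.matrixSubst, Polynomial.algebraMap_apply,
        MvPolynomial.algebraMap_eq]
    · simp [lineExpansion, _root_.matrixSubst, mulVec, dotProduct, Polynomial.algebraMap_apply,
        MvPolynomial.algebraMap_eq, mul_add,
        -Polynomial.X_mul_C, Fin.sum_univ_three]
      ring
  have hF : lineExpansion v (_root_.matrixSubst M F) =
      (lineExpansion (M *ᵥ v) F).map (_root_.matrixSubst M).toRingHom :=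
    congrArg (fun f => f F) key
  obtain ⟨G, hG⟩ := h
  exact ⟨G.map (_root_.matrixSubst M).toRingHom, by rw [hF, hG]; simp⟩

end Substitution

/-! ### Points and lines -/

theorem exists_dual_of_isLine {L : MvPolynomial (Fin 3) ℂ} (hL : IsLine L) :
    ∃ f : Module.Dual ℂ (Fin 3 → ℂ), f ≠ 0 ∧
      ∀ v (hv : v ≠ 0), MemLine L (Projectivization.mk ℂ v hv) ↔ f v = 0 := by
  have hspan : L ∈ Submodule.span ℂ (Set.range (X : Fin 3 → MvPolynomial (Fin 3) ℂ)) := by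
    rw [← homogeneousSubmodule_one_eq_span_X]
    exact hL.2
  obtain ⟨c, hc⟩ := (Submodule.mem_span_range_iff_exists_fun ℂ).1 hspan
  let f : Module.Dual ℂ (Fin 3 → ℂ) := ∑ i, c i • LinearMap.proj i
  have hf : ∀ v, eval v L = f v := fun v => by simp [f, ← hc, smul_eval]
  refine ⟨f, fun h => hL.1 (MvPolynomial.funext fun v => ?_), fun v hv => ⟨fun h => ?_, ?_⟩⟩
  · rw [hf, h]; simp
  · rw [← hf]; exact h v hv rfl
  · intro h w hw hwv
    obtain ⟨a, ha⟩ := (Projectivization.mk_eq_mk_iff' ℂ w v hw hv).1 hwv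
    rw [hf, ← ha, map_smul, h, smul_zero]

theorem dual_eq_zero_of_pair {f g : Module.Dual ℂ (Fin 3 → ℂ)} (hf : f ≠ 0) {u v w : Fin 3 → ℂ}
    (hu : u ≠ 0) (hv : v ≠ 0)
    (huv : Projectivization.mk ℂ u hu ≠ Projectivization.mk ℂ v hv)
    (hfu : f u = 0) (hfv : f v = 0) (hgu : g u = 0) (hgv : g v = 0) (hfw : f w = 0) : g w = 0 := by
  have hli : LinearIndependent ℂ ![u, v] := by
    rw [LinearIndependent.pair_iff' hu]
    exact fun a ha => huv ((Projectivization.mk_eq_mk_iff' ℂ u v hu hv).2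
      ⟨a⁻¹, by
        have : a ≠ 0 := by rintro rfl; exact hv (by simpa using ha.symm)
        rw [← ha, smul_smul, inv_mul_cancel₀ this, one_smul]⟩)
  have hle : ∀ {k : Module.Dual ℂ (Fin 3 → ℂ)}, k u = 0 → k v = 0 →
      Submodule.span ℂ (Set.range ![u, v]) ≤ LinearMap.ker k := fun {k} h₁ h₂ => by
    rw [Submodule.span_le]
    rintro _ ⟨i, rfl⟩
    fin_cases i <;> simpa
  have hker := Module.Dual.finrank_ker_add_one_of_ne_zero hf
  have heq : Submodule.span ℂ (Set.range ![u, v]) = LinearMap.ker f := by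
    refine Submodule.eq_of_le_of_finrank_eq (hle hfu hfv) ?_
    rw [finrank_span_eq_card hli]
    simp at hker ⊢
    omega
  exact hle hgu hgv (heq ▸ LinearMap.mem_ker.2 hfw)

/-! ### The configuration in normalized coordinates -/

/-- The coordinate points together with five points of the line `X₀ + X₁ + X₂ = 0`, two of which
lie on coordinate lines through `(1 : 0 : 0)`. -/
def normalPoints (t₁ t₂ t₃ : ℂ) : Set (Fin 3 → ℂ) :=
  {![1, 0, 0], ![0, 1, 0], ![0, 0, 1], ![1, -1, -1 - -1], ![1, 0, -1 - 0],
    ![1, t₁, -1 - t₁], ![1, t₂, -1 - t₂], ![1, t₃, -1 - t₃]}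

/-- The curve of degree `17` that vanishes to order `7` at all the normalized points. -/
noncomputable def extremalCurve (t₁ t₂ t₃ : ℂ) : MvPolynomial (Fin 3) ℂ :=
  unitLine ^ 5 * X 0 ^ 2 * X 1 ^ 2 * X 2 ^ 2 *
    (pairConic t₁ t₂ * pairConic t₁ t₃ * pairConic t₂ t₃)

theorem isHomogeneous_extremalCurve (t₁ t₂ t₃ : ℂ) :
    (extremalCurve t₁ t₂ t₃).IsHomogeneous 17 :=
  ((((isHomogeneous_unitLine.pow 5).mul ((isHomogeneous_X ℂ 0).pow 2)).mul
    ((isHomogeneous_X ℂ 1).pow 2)).mul ((isHomogeneous_X ℂ 2).pow 2)).mul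
    (((isHomogeneous_coordConic _ _).mul (isHomogeneous_coordConic _ _)).mul
      (isHomogeneous_coordConic _ _))

theorem pairConic_ne_zero (t u : ℂ) : pairConic t u ≠ 0 := fun h => by
  have h₀ := congrArg (eval ![0, 1, 1]) h
  simp [pairConic, coordConic] at h₀

theorem extremalCurve_ne_zero (t₁ t₂ t₃ : ℂ) : extremalCurve t₁ t₂ t₃ ≠ 0 := by
  have hline : unitLine ≠ 0 := fun h => by
    have h₀ := congrArg (eval ![1, 0, 0]) h
    simp [unitLine] at h₀
  simp [extremalCurve, hline, pairConic_ne_zero]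

/-- Orders of vanishing of the factors of the pulled back extremal curve add up. -/
theorem vanishesToOrder_matrixSubst_extremalCurve (N : Matrix (Fin 3) (Fin 3) ℂ) {t₁ t₂ t₃ c : ℂ}
    {v w : Fin 3 → ℂ} (hw : w ∈ normalPoints t₁ t₂ t₃) (hv : N.mulVec v = c • w) :
    VanishesToOrder 7 (matrixSubst N (extremalCurve t₁ t₂ t₃)) v := by
  have factor : ∀ (G : MvPolynomial (Fin 3) ℂ) (d : ℕ), G.IsHomogeneous d → ∃ k : ℕ,
      VanishesToOrder k (matrixSubst N G) v ∧ (eval w G = 0 → k = 1) := fun G d hG => by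
    by_cases h : eval w G = 0
    · refine ⟨1, vanishesToOrder_one ?_, fun _ => rfl⟩
      have := aeval_mul_of_isHomogeneous hG c w
      rw [eval_matrixSubst, hv]
      rw [aeval_eq_eval, aeval_eq_eval, h, mul_zero] at this
      exact this
    · exact ⟨0, vanishesToOrder_zero _ _, fun h' => absurd h' h⟩
  obtain ⟨k, hk, ek⟩ := factor unitLine 1 isHomogeneous_unitLine
  obtain ⟨k₀, hk₀, ek₀⟩ := factor (X 0) 1 (isHomogeneous_X _ _)
  obtain ⟨k₁, hk₁, ek₁⟩ := factor (X 1) 1 (isHomogeneous_X _ _)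
  obtain ⟨k₂, hk₂, ek₂⟩ := factor (X 2) 1 (isHomogeneous_X _ _)
  obtain ⟨l₃, hl₃, el₃⟩ := factor (pairConic t₁ t₂) 2 (isHomogeneous_coordConic _ _)
  obtain ⟨l₂, hl₂, el₂⟩ := factor (pairConic t₁ t₃) 2 (isHomogeneous_coordConic _ _)
  obtain ⟨l₁, hl₁, el₁⟩ := factor (pairConic t₂ t₃) 2 (isHomogeneous_coordConic _ _)
  have hprod := ((((hk.pow 5).mul (hk₀.pow 2)).mul (hk₁.pow 2)).mul (hk₂.pow 2)).mul
    ((hl₃.mul hl₂).mul hl₁)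
  simp only [← map_pow, ← map_mul] at hprod
  have conic_left : ∀ t u : ℂ, eval ![1, t, -1 - t] (pairConic t u) = 0 := fun t u => by
    simp [pairConic, coordConic]; ring
  have conic_right : ∀ t u : ℂ, eval ![1, u, -1 - u] (pairConic t u) = 0 := fun t u => by
    simp [pairConic, coordConic]; ring
  have line : ∀ t : ℂ, eval ![1, t, -1 - t] unitLine = 0 := fun t => by
    simp [unitLine]
  refine hprod.mono ?_
  simp only [normalPoints, Set.mem_insert_iff, Set.mem_singleton_iff] at hw
  rcases hw with rfl | rfl | rfl | rfl | rfl | rfl | rfl | rfl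
  · have := ek₁ (by simp)
    have := ek₂ (by simp)
    have := el₁ (by simp [pairConic, coordConic])
    have := el₂ (by simp [pairConic, coordConic])
    have := el₃ (by simp [pairConic, coordConic])
    omega
  · have := ek₀ (by simp)
    have := ek₂ (by simp)
    have := el₁ (by simp [pairConic, coordConic])
    have := el₂ (by simp [pairConic, coordConic])
    have := el₃ (by simp [pairConic, coordConic])
    omega
  · have := ek₀ (by simp)
    have := ek₁ (by simp)
    have := el₁ (by simp [pairConic, coordConic])
    have := el₂ (by simp [pairConic, coordConic])
    have := el₃ (by simp [pairConic, coordConic])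
    omega
  · have := ek (line _)
    have := ek₂ (by simp)
    omega
  · have := ek (line _)
    have := ek₁ (by simp)
    omega
  · have := ek (line _)
    have := el₃ (conic_left _ _)
    have := el₂ (conic_left _ _)
    omega
  · have := ek (line _)
    have := el₃ (conic_right _ _)
    have := el₁ (conic_left _ _)
    omega
  · have := ek (line _)
    have := el₂ (conic_right _ _)
    have := el₁ (conic_right _ _)
    omega

/-- The Waldschmidt constant of a set of points that is the image of the normalized points. -/
theorem waldschmidt_eq_of_normalPoints {Z : Set (ℙ ℂ (Fin 3 → ℂ))}
    {M N : Matrix (Fin 3) (Fin 3) ℂ} (hMN : M * N = 1) (hNM : N * M = 1) {t₁ t₂ t₃ : ℂ}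
    (h10 : t₁ ≠ 0) (h11 : 1 + t₁ ≠ 0) (h20 : t₂ ≠ 0) (h21 : 1 + t₂ ≠ 0) (h30 : t₃ ≠ 0)
    (h31 : 1 + t₃ ≠ 0) (h12 : t₁ ≠ t₂) (h13 : t₁ ≠ t₃) (h23 : t₂ ≠ t₃)
    (hZ : ∀ v (hv : v ≠ 0), Projectivization.mk ℂ v hv ∈ Z ↔
      ∃ w ∈ normalPoints t₁ t₂ t₃, ∃ c : ℂ, N.mulVec v = c • w) :
    waldschmidt Z = 17 / 7 := by
  set D := matrixSubst N (extremalCurve t₁ t₂ t₃) with hD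
  have hD0 : D ≠ 0 := matrixSubst_ne_zero hNM (extremalCurve_ne_zero _ _ _)
  have hDhom : D.IsHomogeneous 17 :=
    isHomogeneous_matrixSubst N (isHomogeneous_extremalCurve _ _ _)
  have hDmem : D ∈ symbolicPower Z 7 := by
    rintro _ hP v hv rfl
    obtain ⟨w, hw, c, hc⟩ := (hZ v hv).1 hP
    exact vanishesToOrder_matrixSubst_extremalCurve N hw hc
  have lower : ∀ (m t : ℕ), ∀ F ∈ symbolicPower Z m, F ≠ 0 → F.IsHomogeneous t →
      34 * m ≤ 14 * t := by
    intro m t F hF hF0 hFt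
    have mult : ∀ w ∈ normalPoints t₁ t₂ t₃, w ≠ 0 → HasMult m (matrixSubst M F) w := by
      intro w hw hw0
      have hNw : N.mulVec (M.mulVec w) = w := by simp [hNM]
      have hne : M.mulVec w ≠ 0 := fun h => hw0 (by rw [← hNw, h]; simp)
      exact (hF _ ((hZ _ hne).2 ⟨w, hw, 1, by rw [hNw, one_smul]⟩) _ hne rfl).hasMult.matrixSubst M
    have ne : ∀ s : ℂ, ![1, s, -1 - s] ≠ 0 := fun s h => by simpa using congrFun h 0
    have := weighted_mult_le h10 h11 h20 h21 h30 h31 h12 h13 h23 t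
      (matrixSubst_ne_zero hMN hF0) (isHomogeneous_matrixSubst M hFt)
      (mult ![1, 0, 0] (by simp [normalPoints]) fun h => by simpa using congrFun h 0)
      (mult ![0, 1, 0] (by simp [normalPoints]) fun h => by simpa using congrFun h 1)
      (mult ![0, 0, 1] (by simp [normalPoints]) fun h => by simpa using congrFun h 2)
      (mult _ (by simp [normalPoints]) (ne _)) (mult _ (by simp [normalPoints]) (ne _))
      (mult _ (by simp [normalPoints]) (ne _)) (mult _ (by simp [normalPoints]) (ne _))
      (mult _ (by simp [normalPoints]) (ne _))
    omega
  apply le_antisymm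
  · have hbdd : BddBelow (Set.range fun m : ℕ+ =>
        (initialDegree (symbolicPower Z (m : ℕ)) : ℝ) / ((m : ℕ) : ℝ)) :=
      ⟨0, by rintro _ ⟨m, rfl⟩; positivity⟩
    have hle : initialDegree (symbolicPower Z 7) ≤ 17 := Nat.sInf_le ⟨D, hDmem, hD0, hDhom⟩
    refine (ciInf_le hbdd 7).trans ?_
    have : (initialDegree (symbolicPower Z 7) : ℝ) ≤ 17 := by exact_mod_cast hle
    simpa using div_le_div_of_nonneg_right this (by norm_num : (0 : ℝ) ≤ 7)
  · refine le_ciInf fun m => ?_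
    have hne : {t | ∃ F ∈ symbolicPower Z (m : ℕ), F ≠ 0 ∧ F.IsHomogeneous t}.Nonempty :=
      ⟨17 * m, D ^ (m : ℕ), fun P hP v hv hvP => ((hDmem P hP v hv hvP).pow m).mono (by omega),
        pow_ne_zero _ hD0, hDhom.pow m⟩
    obtain ⟨F, hF, hF0, hFt⟩ := Nat.sInf_mem hne
    have hle : 34 * (m : ℕ) ≤ 14 * initialDegree (symbolicPower Z (m : ℕ)) :=
      lower m _ F hF hF0 hFt
    have hle' : (34 : ℝ) * (m : ℕ) ≤ 14 * initialDegree (symbolicPower Z (m : ℕ)) := by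
      exact_mod_cast hle
    have hm : (0 : ℝ) < (m : ℕ) := by exact_mod_cast m.pos
    rw [div_le_div_iff₀ (by norm_num) hm]
    linarith

/-! ### Reduction to normalized coordinates -/

theorem exists_rep_dual_eq_one {L : MvPolynomial (Fin 3) ℂ} {f : Module.Dual ℂ (Fin 3 → ℂ)}
    (hf : ∀ v (hv : v ≠ 0), MemLine L (Projectivization.mk ℂ v hv) ↔ f v = 0)
    {x : ℙ ℂ (Fin 3 → ℂ)} (hx : ¬ MemLine L x) :
    ∃ (v : Fin 3 → ℂ) (hv : v ≠ 0), Projectivization.mk ℂ v hv = x ∧ f v = 1 := by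
  induction x using Projectivization.ind with
  | h v hv =>
    have hfv : f v ≠ 0 := fun h => hx ((hf v hv).2 h)
    refine ⟨(f v)⁻¹ • v, smul_ne_zero (inv_ne_zero hfv) hv, ?_, by simp [hfv]⟩
    exact (Projectivization.mk_eq_mk_iff' ℂ _ _ _ _).2 ⟨(f v)⁻¹, rfl⟩

theorem mk_eq_mk_mulVec_iff {M N : Matrix (Fin 3) (Fin 3) ℂ} (hMN : M * N = 1) (hNM : N * M = 1)
    {v w : Fin 3 → ℂ} (hv : v ≠ 0) (hw : M.mulVec w ≠ 0) :
    Projectivization.mk ℂ v hv = Projectivization.mk ℂ (M.mulVec w) hw ↔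
      ∃ c : ℂ, N.mulVec v = c • w := by
  rw [Projectivization.mk_eq_mk_iff']
  refine exists_congr fun c => ⟨fun h => ?_, fun h => ?_⟩
  · rw [← h, Matrix.mulVec_smul, Matrix.mulVec_mulVec, hNM, Matrix.one_mulVec]
  · rw [← Matrix.mulVec_smul, ← h, Matrix.mulVec_mulVec, hMN, Matrix.one_mulVec]

/-- The members of `Z`, sorted by their position relative to the line that contains five of
them. -/
theorem exists_mem_iff_of_ncard {α : Type*} {Z l : Set α} (hfin : Z.Finite) (hcard : Z.ncard = 8)
    (hl : (Z ∩ l).ncard = 5) {p a b x y : α} (hp : p ∈ Z) (ha : a ∈ Z) (hb : b ∈ Z) (hx : x ∈ Z)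
    (hy : y ∈ Z) (hpl : p ∉ l) (hal : a ∉ l) (hbl : b ∉ l) (hxl : x ∈ l) (hyl : y ∈ l)
    (hap : a ≠ p) (hbp : b ≠ p) (hab : a ≠ b) (hxy : x ≠ y) :
    ∃ r₁ r₂ r₃, (r₁ ∈ (Z ∩ l) \ {x, y} ∧ r₂ ∈ (Z ∩ l) \ {x, y} ∧ r₃ ∈ (Z ∩ l) \ {x, y}) ∧
      r₁ ≠ r₂ ∧ r₁ ≠ r₃ ∧ r₂ ≠ r₃ ∧
      ∀ z, z ∈ Z ↔ z = p ∨ z = a ∨ z = b ∨ z = x ∨ z = y ∨ z = r₁ ∨ z = r₂ ∨ z = r₃ := by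
  have hoff : {p, a, b} = Z \ l := by
    have hsub : {p, a, b} ⊆ Z \ l := by
      rintro z (rfl | rfl | rfl) <;> constructor <;> assumption
    refine Set.eq_of_subset_of_ncard_le hsub ?_ (hfin.subset Set.sdiff_subset)
    have h₃ : ({p, a, b} : Set α).ncard = 3 :=
      Set.ncard_eq_three.2 ⟨p, a, b, hap.symm, hbp.symm, hab, rfl⟩
    have := Set.ncard_inter_add_ncard_sdiff_eq_ncard Z l hfin
    omega
  have hpair : {x, y} ⊆ Z ∩ l := by
    rintro z (rfl | rfl) <;> constructor <;> assumption
  have hrest : ((Z ∩ l) \ {x, y}).ncard = 3 := by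
    rw [Set.ncard_sdiff hpair (Set.toFinite _), hl, Set.ncard_pair hxy]
  obtain ⟨r₁, r₂, r₃, h12, h13, h23, hr⟩ := Set.ncard_eq_three.1 hrest
  refine ⟨r₁, r₂, r₃, by simp [hr], h12, h13, h23, fun z => ?_⟩
  have h₁ := Set.ext_iff.1 hoff z
  have h₂ := Set.ext_iff.1 hr z
  have h₃ := @hpair z
  simp only [Set.mem_insert_iff, Set.mem_singleton_iff, Set.mem_sdiff, Set.mem_inter_iff] at h₁ h₂ h₃
  grind

end AuxiliaryResults

/-- Configuration `H(8,136)`: eight points of `ℙ²` with a line `L` containing exactly five of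
them, among them `Q₁` and `Q₂`; a point `P` off `L`; a point `A` on the line `L₁` through `P`
and `Q₁` with `A ∉ {P, Q₁}` and `A` off `L`; a point `B` on the line `L₂` through `P` and `Q₂`
with `B ∉ {P, Q₂}` and `B` off `L`; the intersection point of the line `L₃` through `A` and `B`
with `L` does not belong to `Z`; and the only collinear triples among the eight points are those
contained in `L`, `L₁` or `L₂`. Then `α̂(I) = 17/7`. -/
theorem H8_136 (Z : Set (ℙ ℂ (Fin 3 → ℂ))) (hfin : Z.Finite) (hcard : Z.ncard = 8)
    (hconf : ∃ L L₁ L₂ L₃ : MvPolynomial (Fin 3) ℂ, ∃ Q₁ Q₂ P A B : ℙ ℂ (Fin 3 → ℂ),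
      IsLine L ∧ IsLine L₁ ∧ IsLine L₂ ∧ IsLine L₃ ∧
      Q₁ ∈ Z ∧ Q₂ ∈ Z ∧ P ∈ Z ∧ A ∈ Z ∧ B ∈ Z ∧
      Q₁ ≠ Q₂ ∧
      MemLine L Q₁ ∧ MemLine L Q₂ ∧
      (Z ∩ {x | MemLine L x}).ncard = 5 ∧
      ¬ MemLine L P ∧
      MemLine L₁ P ∧ MemLine L₁ Q₁ ∧ MemLine L₁ A ∧ A ≠ P ∧ A ≠ Q₁ ∧ ¬ MemLine L A ∧
      MemLine L₂ P ∧ MemLine L₂ Q₂ ∧ MemLine L₂ B ∧ B ≠ P ∧ B ≠ Q₂ ∧ ¬ MemLine L B ∧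
      A ≠ B ∧ MemLine L₃ A ∧ MemLine L₃ B ∧
      (∀ X ∈ Z, ¬ (MemLine L₃ X ∧ MemLine L X)) ∧
      (∀ X Y W, X ∈ Z → Y ∈ Z → W ∈ Z → X ≠ Y → X ≠ W → Y ≠ W → Collin X Y W →
        ((MemLine L X ∧ MemLine L Y ∧ MemLine L W) ∨
         (MemLine L₁ X ∧ MemLine L₁ Y ∧ MemLine L₁ W) ∨
         (MemLine L₂ X ∧ MemLine L₂ Y ∧ MemLine L₂ W)))) :
    waldschmidt Z = 17 / 7 := by
  obtain ⟨L, L₁, L₂, L₃, Q₁, Q₂, P, A, B, hL, hL₁, hL₂, hL₃, hQ₁Z, hQ₂Z, hPZ, hAZ, hBZ, hQ, hLQ₁,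
    hLQ₂, hfive, hLP, h₁P, h₁Q₁, h₁A, hAP, -, hLA, h₂P, h₂Q₂, h₂B, hBP, -, hLB, hAB, h₃A, h₃B,
    h₃, -⟩ := hconf
  obtain ⟨R₁, R₂, R₃, ⟨hR₁, hR₂, hR₃⟩, hR₁₂, hR₁₃, hR₂₃, hZ⟩ :=
    exists_mem_iff_of_ncard hfin hcard hfive hPZ hAZ hBZ hQ₁Z hQ₂Z hLP hLA hLB hLQ₁ hLQ₂ hAP hBP
      hAB hQ
  obtain ⟨f, -, hf⟩ := exists_dual_of_isLine hL
  obtain ⟨f₁, hf₁0, hf₁⟩ := exists_dual_of_isLine hL₁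
  obtain ⟨f₂, hf₂0, hf₂⟩ := exists_dual_of_isLine hL₂
  obtain ⟨f₃, -, hf₃⟩ := exists_dual_of_isLine hL₃
  obtain ⟨p, hp, rfl, hfp⟩ := exists_rep_dual_eq_one hf hLP
  obtain ⟨a, ha, rfl, hfa⟩ := exists_rep_dual_eq_one hf hLA
  obtain ⟨b, hb, rfl, hfb⟩ := exists_rep_dual_eq_one hf hLB
  obtain ⟨q₁, hq₁, rfl⟩ : ∃ v hv, Projectivization.mk ℂ v hv = Q₁ :=
    ⟨Q₁.rep, Q₁.rep_nonzero, Q₁.mk_rep⟩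
  obtain ⟨q₂, hq₂, rfl⟩ : ∃ v hv, Projectivization.mk ℂ v hv = Q₂ :=
    ⟨Q₂.rep, Q₂.rep_nonzero, Q₂.mk_rep⟩
  rw [hf] at hLQ₁ hLQ₂
  rw [hf₁] at h₁P h₁Q₁ h₁A
  rw [hf₂] at h₂P h₂Q₂ h₂B
  rw [hf₃] at h₃A h₃B
  have hfp0 : f p ≠ 0 := by simp [hfp]
  have hlines : ∀ {v : Fin 3 → ℂ} (hv : v ≠ 0),
      Projectivization.mk ℂ v hv ≠ Projectivization.mk ℂ p hp → f₁ v = 0 → f₂ v = 0 → False :=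
    fun hv hne h h' =>
      have h₁₂ : f₁ q₂ = 0 := dual_eq_zero_of_pair hf₂0 hv hp hne h' h₂P h h₁P h₂Q₂
      hfp0 (dual_eq_zero_of_pair hf₁0 hq₁ hq₂ hQ h₁Q₁ h₁₂ hLQ₁ hLQ₂ h₁P)
  have h₁B : f₁ b ≠ 0 := fun h => hlines hb hBP h h₂B
  have h₂A : f₂ a ≠ 0 := fun h => hlines ha hAP h₁A h
  set M : Matrix (Fin 3) (Fin 3) ℂ := (Matrix.of ![p, a, b]).transpose with hM
  have hMv : ∀ v, M.mulVec v = v 0 • p + v 1 • a + v 2 • b := fun v => by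
    ext i
    simp [hM, Matrix.mulVec, dotProduct, Fin.sum_univ_three, mul_comm]
  have hinj : Function.Injective M.mulVec := by
    refine (injective_iff_map_eq_zero M.mulVecLin).2 fun v hv => ?_
    rw [Matrix.mulVecLin_apply, hMv] at hv
    have hv2 : v 2 = 0 := by simpa [h₁P, h₁A, h₁B] using congrArg f₁ hv
    have hv1 : v 1 = 0 := by simpa [h₂P, h₂B, h₂A] using congrArg f₂ hv
    have hv0 : v 0 = 0 := by simpa [hv1, hv2, hp] using hv
    ext i
    fin_cases i <;> assumption
  have hdet : IsUnit M.det :=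
    (Matrix.isUnit_iff_isUnit_det M).1 (Matrix.mulVec_injective_iff_isUnit.1 hinj)
  have hMN : M * M⁻¹ = 1 := M.mul_nonsing_inv hdet
  have hNM : M⁻¹ * M = 1 := M.nonsing_inv_mul hdet
  have hne : ∀ {w : Fin 3 → ℂ}, w ≠ 0 → M.mulVec w ≠ 0 := fun hw h =>
    hw (hinj (by rw [h, Matrix.mulVec_zero]))
  have hpt : ∀ s : ℂ, ![1, s, -1 - s] ≠ 0 := fun s h => by simpa using congrFun h 0
  have hline : ∀ X ∈ Z, MemLine L X → ∃ s : ℂ,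
      X = Projectivization.mk ℂ (M.mulVec ![1, s, -1 - s]) (hne (hpt s)) := by
    intro X hXZ hXL
    induction X using Projectivization.ind with
    | h v hv =>
      obtain ⟨w, rfl⟩ : ∃ w, M.mulVec w = v := ⟨M⁻¹.mulVec v, by simp [hMN]⟩
      have hw : w 0 + w 1 + w 2 = 0 := by
        simpa [hMv, hfp, hfa, hfb] using (hf _ hv).1 hXL
      have hw0 : w 0 ≠ 0 := fun h0 => h₃ _ hXZ ⟨(hf₃ _ hv).2 (by simp [hMv, h0, h₃A, h₃B]), hXL⟩
      refine ⟨w 1 / w 0, (mk_eq_mk_mulVec_iff hMN hNM hv _).2 ⟨w 0, ?_⟩⟩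
      rw [Matrix.mulVec_mulVec, hNM, Matrix.one_mulVec]
      ext i
      fin_cases i
      · simp
      · simp; field_simp
      · simp; field_simp; linear_combination hw
  have hQ₁' : Projectivization.mk ℂ q₁ hq₁ =
      Projectivization.mk ℂ (M.mulVec ![1, -1, -1 - -1]) (hne (hpt _)) := by
    obtain ⟨s, hs⟩ := hline _ hQ₁Z ((hf _ _).2 hLQ₁)
    have h0 := (hf₁ _ _).1 (hs ▸ (hf₁ _ hq₁).2 h₁Q₁)
    obtain rfl : s = -1 := by
      have : -1 - s = 0 := by simpa [hMv, h₁P, h₁A, h₁B] using h0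
      linear_combination -this
    exact hs
  have hQ₂' : Projectivization.mk ℂ q₂ hq₂ =
      Projectivization.mk ℂ (M.mulVec ![1, 0, -1 - 0]) (hne (hpt _)) := by
    obtain ⟨s, hs⟩ := hline _ hQ₂Z ((hf _ _).2 hLQ₂)
    have h0 := (hf₂ _ _).1 (hs ▸ (hf₂ _ hq₂).2 h₂Q₂)
    obtain rfl : s = 0 := by simpa [hMv, h₂P, h₂B, h₂A] using h0
    exact hs
  rw [hQ₁', hQ₂'] at hZ hR₁ hR₂ hR₃
  obtain ⟨t₁, rfl⟩ := hline R₁ hR₁.1.1 hR₁.1.2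
  obtain ⟨t₂, rfl⟩ := hline R₂ hR₂.1.1 hR₂.1.2
  obtain ⟨t₃, rfl⟩ := hline R₃ hR₃.1.1 hR₃.1.2
  have hoff : ∀ {s : ℂ}, Projectivization.mk ℂ (M.mulVec ![1, s, -1 - s]) (hne (hpt s)) ∈
      (Z ∩ {x | MemLine L x}) \
        {Projectivization.mk ℂ (M.mulVec ![1, -1, -1 - -1]) (hne (hpt _)),
          Projectivization.mk ℂ (M.mulVec ![1, 0, -1 - 0]) (hne (hpt _))} →
      s ≠ 0 ∧ 1 + s ≠ 0 := by
    rintro s ⟨-, h⟩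
    refine ⟨?_, fun hs => ?_⟩
    · rintro rfl
      exact h (Or.inr rfl)
    · obtain rfl : s = -1 := by linear_combination hs
      exact h (Or.inl rfl)
  refine waldschmidt_eq_of_normalPoints hMN hNM (hoff hR₁).1 (hoff hR₁).2 (hoff hR₂).1 (hoff hR₂).2
    (hoff hR₃).1 (hoff hR₃).2 (fun h => hR₁₂ (by subst h; rfl)) (fun h => hR₁₃ (by subst h; rfl))
    (fun h => hR₂₃ (by subst h; rfl)) fun v hv => ?_
  have hcoord : M.mulVec ![1, 0, 0] = p ∧ M.mulVec ![0, 1, 0] = a ∧ M.mulVec ![0, 0, 1] = b := by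
    simp [hMv]
  obtain ⟨hMp, hMa, hMb⟩ := hcoord
  have hP' := mk_eq_mk_mulVec_iff hMN hNM hv (w := ![1, 0, 0]) (hMp ▸ hp)
  have hA' := mk_eq_mk_mulVec_iff hMN hNM hv (w := ![0, 1, 0]) (hMa ▸ ha)
  have hB' := mk_eq_mk_mulVec_iff hMN hNM hv (w := ![0, 0, 1]) (hMb ▸ hb)
  simp only [hMp, hMa, hMb] at hP' hA' hB'
  rw [hZ, hP', hA', hB']
  simp only [mk_eq_mk_mulVec_iff hMN hNM, normalPoints, Set.mem_insert_iff, Set.mem_singleton_iff,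
    or_and_right, exists_or, exists_eq_left]
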